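/- Let k₀ ∈ (0,1), let β be a fragment daughter distribution satisfying the mass-transfer form, local mass conservation, and the non-integrability bounds, let Φ be the collision kernel with exponents k₀ ≤ λ₁ ≤ λ₂ ≤ 1, let T ∈ (0,∞], and let u be a weak solution to the collision-induced fragmentation equation on [0,T) with nonnegative initial condition u^in ∈ X_{k₀} ∩ X₁, satisfying additionally ∫₀^t ∫₀^∞ ∫₀^∞ (x₁+x₂) Φ(x₁,x₂) u(τ,x₁) u(τ,x₂) dx₁ dx₂ dτ < ∞ for every t ∈ (0,T). Then for every ς : [0,∞) → ℝ that is Hölder continuous with exponent k₀, satisfies ς(0) = 0 and sup_{x>1} |ς(x)|/x < ∞, and for every t ∈ (0,T), one has ∫₀^∞ ς(x₁) u(t,x₁) dx₁ = ∫₀^∞ ς(x₁) u^in(x₁) dx₁ + (1/2)∫₀^t∫₀^∞∫₀^∞ Υ_ς(x₁,x₂) Φ(x₁,x₂) u(τ,x₁) u(τ,x₂) dx₂ dx₁ dτ. -/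

import Mathlib

open MeasureTheory Set Filter
open scoped ENNReal

noncomputable section

/-- The `k`-th moment `M_k(g) = ∫₀^∞ x^k g(x) dx`. -/
def Mk (k : ℝ) (g : ℝ → ℝ) : ℝ := ∫ x in Ioi (0:ℝ), x ^ k * g x

/-- Membership in the weighted space `X_k`. -/
def MemXk (k : ℝ) (g : ℝ → ℝ) : Prop :=
  MeasureTheory.IntegrableOn (fun x => x ^ k * g x) (Ioi (0:ℝ))

/-- The fragment daughter distribution built from `β_*` via the mass-transfer form
`β(x₃,x₁,x₂) = β_*(x₃,x₁,x₂)·1_{(0,x₁)}(x₃) + β_*(x₃,x₂,x₁)·1_{(0,x₂)}(x₃)`. -/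
def betaOf (bs : ℝ → ℝ → ℝ → ℝ) (x₃ x₁ x₂ : ℝ) : ℝ :=
  (if x₃ ∈ Ioo (0:ℝ) x₁ then bs x₃ x₁ x₂ else 0) +
  (if x₃ ∈ Ioo (0:ℝ) x₂ then bs x₃ x₂ x₁ else 0)

/-- The power-law `β_*(x₃,x₁,x₂) = (ν+2) x₃^ν x₁^{-ν-1} 1_{(0,x₁)}(x₃)`. -/
def betaPow (ν : ℝ) (x₃ x₁ x₂ : ℝ) : ℝ :=
  if x₃ ∈ Ioo (0:ℝ) x₁ then (ν + 2) * x₃ ^ ν * x₁ ^ (-ν - 1) else 0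

/-- The collision kernel `Φ(x₁,x₂) = x₁^{λ₁} x₂^{λ₂} + x₂^{λ₁} x₁^{λ₂}`. -/
def Phi (l₁ l₂ : ℝ) (x₁ x₂ : ℝ) : ℝ := x₁ ^ l₁ * x₂ ^ l₂ + x₂ ^ l₁ * x₁ ^ l₂

/-- `Υ_ς(x₁,x₂) = ∫₀^{x₁+x₂} ς(x₃) β(x₃,x₁,x₂) dx₃ - ς(x₁) - ς(x₂)`, where `β = betaOf bs`. -/
def Upsilon (bs : ℝ → ℝ → ℝ → ℝ) (ς : ℝ → ℝ) (x₁ x₂ : ℝ) : ℝ :=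
  (∫ x₃ in Ioo (0:ℝ) (x₁ + x₂), ς x₃ * betaOf bs x₃ x₁ x₂) - ς x₁ - ς x₂

/-- Assumptions on `β_*`: measurability, nonnegativity, local mass conservation, and the
non-integrability bounds `∫₀^{x₁} x₃^{k₀} β_*(x₃,x₁,x₂)^p dx₃ ≤ E_{k₀,p} x₁^{k₀+1-p}`
for `p ∈ [1,p₀]`, some `p₀ ∈ (1,1+k₀)`. -/
structure FragKernel (k₀ : ℝ) (bs : ℝ → ℝ → ℝ → ℝ) : Prop where
  meas : Measurable fun q : ℝ × ℝ × ℝ => bs q.1 q.2.1 q.2.2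
  nonneg : ∀ x₃ x₁ x₂ : ℝ, 0 ≤ bs x₃ x₁ x₂
  mass : ∀ x₁ ∈ Ioi (0:ℝ), ∀ x₂ ∈ Ioi (0:ℝ),
    ∫ x₃ in Ioo (0:ℝ) x₁, x₃ * bs x₃ x₁ x₂ = x₁
  bound : ∃ p₀ ∈ Ioo (1:ℝ) (1 + k₀), ∀ p ∈ Icc (1:ℝ) p₀, ∃ E : ℝ, 0 < E ∧
    ∀ x₁ ∈ Ioi (0:ℝ), ∀ x₂ ∈ Ioi (0:ℝ),
      ∫ x₃ in Ioo (0:ℝ) x₁, x₃ ^ k₀ * (bs x₃ x₁ x₂) ^ p ≤ E * x₁ ^ (k₀ + 1 - p)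

/-- `ς(0) = 0` and `ς` is Hölder continuous with exponent `k₀` on `[0,∞)`. -/
def HolderZero (k₀ : ℝ) (ς : ℝ → ℝ) : Prop :=
  ς 0 = 0 ∧ ∃ H : ℝ, ∀ a b : ℝ, 0 ≤ a → 0 ≤ b → |ς a - ς b| ≤ H * |a - b| ^ k₀

/-- `ς` is bounded on `[0,∞)`. -/
def BddOnNonneg (ς : ℝ → ℝ) : Prop := ∃ C : ℝ, ∀ x : ℝ, 0 ≤ x → |ς x| ≤ C

/-- A weak solution on `[0,T)` to the collision-induced fragmentation equation with
daughter distribution `betaOf bs` and collision kernel `K`. -/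
structure IsWeakSolution (k₀ : ℝ) (bs : ℝ → ℝ → ℝ → ℝ) (K : ℝ → ℝ → ℝ)
    (uin : ℝ → ℝ) (T : ℝ≥0∞) (u : ℝ → ℝ → ℝ) : Prop where
  meas : Measurable (Function.uncurry u)
  nonneg : ∀ t : ℝ, 0 ≤ t → ENNReal.ofReal t < T → ∀ x ∈ Ioi (0:ℝ), 0 ≤ u t x
  init : ∀ x ∈ Ioi (0:ℝ), u 0 x = uin x
  cont : ∀ g : ℝ → ℝ, Measurable g → (∃ C : ℝ, ∀ x : ℝ, |g x| ≤ C) →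
    ContinuousOn (fun t => ∫ x in Ioi (0:ℝ), g x * (x ^ k₀ * u t x))
      {t : ℝ | 0 ≤ t ∧ ENNReal.ofReal t < T}
  massBdd : ∃ C : ℝ, ∀ t : ℝ, 0 ≤ t → ENNReal.ofReal t < T →
    (∫⁻ x in Ioi (0:ℝ), ENNReal.ofReal (x * u t x)) ≤ ENNReal.ofReal C
  integ : ∀ t : ℝ, 0 < t → ENNReal.ofReal t < T →
    MeasureTheory.IntegrableOn
      (fun q : ℝ × ℝ × ℝ =>
        (q.2.1 ^ k₀ + q.2.2 ^ k₀) * K q.2.1 q.2.2 * u q.1 q.2.1 * u q.1 q.2.2)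
      (Ioo (0:ℝ) t ×ˢ (Ioi (0:ℝ) ×ˢ Ioi (0:ℝ)))
  weak : ∀ t : ℝ, 0 < t → ENNReal.ofReal t < T → ∀ ς : ℝ → ℝ,
    HolderZero k₀ ς → BddOnNonneg ς →
    ∫ x in Ioi (0:ℝ), ς x * u t x =
      (∫ x in Ioi (0:ℝ), ς x * uin x) +
      (1/2) * ∫ τ in Ioo (0:ℝ) t, ∫ x₁ in Ioi (0:ℝ), ∫ x₂ in Ioi (0:ℝ),
        Upsilon bs ς x₁ x₂ * K x₁ x₂ * u τ x₁ * u τ x₂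

/-- Mass conservation on `[0,T)`. -/
def MassConserving (uin : ℝ → ℝ) (T : ℝ≥0∞) (u : ℝ → ℝ → ℝ) : Prop :=
  ∀ t : ℝ, 0 ≤ t → ENNReal.ofReal t < T → Mk 1 (u t) = Mk 1 uin

/-- The formation term `F` with kernel `K`. -/
def Fform (bs : ℝ → ℝ → ℝ → ℝ) (K : ℝ → ℝ → ℝ) (v : ℝ → ℝ) (x₁ : ℝ) : ℝ :=
  (1/2) * ∫ x₂ in Ioi x₁, ∫ x₃ in Ioo (0:ℝ) x₂,
    betaOf bs x₁ (x₂ - x₃) x₃ * K (x₂ - x₃) x₃ * v (x₂ - x₃) * v x₃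

/-- The loss term `L` with kernel `K`. -/
def Lform (K : ℝ → ℝ → ℝ) (v : ℝ → ℝ) (x₁ : ℝ) : ℝ :=
  v x₁ * ∫ x₂ in Ioi (0:ℝ), K x₁ x₂ * v x₂

/-- The norm of `X_{k₀} ∩ X₁`, i.e. the `L¹` norm with weight `x^{k₀} + x`. -/
def N01 (k₀ : ℝ) (g : ℝ → ℝ) : ℝ := ∫ x in Ioi (0:ℝ), (x ^ k₀ + x) * |g x|

/-- The truncated collision kernel `Φ_n`. -/
def PhiTrunc (l₁ l₂ : ℝ) (n : ℕ) (x₁ x₂ : ℝ) : ℝ :=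
  if x₁ ∈ Ioo ((n:ℝ)⁻¹) (n:ℝ) ∧ x₂ ∈ Ioo ((n:ℝ)⁻¹) (n:ℝ) then Phi l₁ l₂ x₁ x₂ else 0

/-- `u` is a continuously differentiable curve in `X_{k₀} ∩ X₁` on `[0,∞)`, with `u(0) = v0`,
solving `∂ₜ u = F u - L u` in the strong (norm) sense; the derivative
`t ↦ F u(t) - L u(t)` is moreover continuous in the norm of `X_{k₀} ∩ X₁`. -/
def SolvesTrunc (k₀ : ℝ) (bs : ℝ → ℝ → ℝ → ℝ) (K : ℝ → ℝ → ℝ) (v0 : ℝ → ℝ)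
    (u : ℝ → ℝ → ℝ) : Prop :=
  Measurable (Function.uncurry u) ∧
  (∀ x ∈ Ioi (0:ℝ), u 0 x = v0 x) ∧
  (∀ t : ℝ, 0 ≤ t → MemXk k₀ (u t) ∧ MemXk 1 (u t)) ∧
  (∀ t : ℝ, 0 ≤ t →
    Tendsto (fun h : ℝ =>
        N01 k₀ (fun x => (u (t + h) x - u t x) / h - (Fform bs K (u t) x - Lform K (u t) x)))
      (nhdsWithin 0 {h : ℝ | h ≠ 0 ∧ 0 ≤ t + h}) (nhds 0)) ∧
  (∀ t₀ : ℝ, 0 ≤ t₀ →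
    Tendsto (fun t : ℝ =>
        N01 k₀ (fun x =>
          (Fform bs K (u t) x - Lform K (u t) x) - (Fform bs K (u t₀) x - Lform K (u t₀) x)))
      (nhdsWithin t₀ (Ici (0:ℝ))) (nhds 0))

/-- Bundled data and standing assumptions of the paper. -/
structure Setup where
  k₀ : ℝ
  l₁ : ℝ
  l₂ : ℝ
  bs : ℝ → ℝ → ℝ → ℝ
  E₁ : ℝ
  uin : ℝ → ℝ
  hk₀ : k₀ ∈ Ioo (0:ℝ) 1
  hl₁ : k₀ ≤ l₁
  hl₁₂ : l₁ ≤ l₂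
  hl₂ : l₂ ≤ 1
  hβ : FragKernel k₀ bs
  hE₁pos : 0 < E₁
  hE₁ : ∀ x₁ ∈ Ioi (0:ℝ), ∀ x₂ ∈ Ioi (0:ℝ),
    ∫ x₃ in Ioo (0:ℝ) x₁, x₃ ^ k₀ * bs x₃ x₁ x₂ ≤ E₁ * x₁ ^ k₀
  hmeas : Measurable uin
  hnn : ∀ x : ℝ, 0 ≤ uin x
  hXk₀ : MemXk k₀ uin
  hX1 : MemXk 1 uin
  hX1k₀ : MemXk (1 + k₀) uin
  hρ : 0 < Mk 1 uin

/-- Apply a function of the seven quantities `k₀, λ₁, λ₂, ρ, M_{k₀}(u^in), M_{k₀+1}(u^in), E_{k₀,1}`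
to the data of a setup. -/
def app7 {α : Sort*} (f : ℝ → ℝ → ℝ → ℝ → ℝ → ℝ → ℝ → α) (S : Setup) : α :=
  f S.k₀ S.l₁ S.l₂ (Mk 1 S.uin) (Mk S.k₀ S.uin) (Mk (S.k₀ + 1) S.uin) S.E₁

/-- A nonnegative `C¹` solution of the truncated equation with truncated initial condition,
satisfying the mass bound and the `(k₀+1)`-moment bound. -/
def IsTruncSolution (S : Setup) (n : ℕ) (u : ℝ → ℝ → ℝ) : Prop :=
  SolvesTrunc S.k₀ S.bs (PhiTrunc S.l₁ S.l₂ n) ((Ioo (0:ℝ) (2 * n)).indicator S.uin) u ∧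
  (∀ t : ℝ, 0 ≤ t → ∀ x ∈ Ioi (0:ℝ), 0 ≤ u t x) ∧
  (∀ t : ℝ, 0 ≤ t → Mk 1 (u t) ≤ Mk 1 S.uin) ∧
  (∀ t : ℝ, 0 ≤ t → Mk (S.k₀ + 1) (u t) ≤ Mk (S.k₀ + 1) S.uin)

end

noncomputable section

/-- Robust to junk values: difference of Bochner integrals bounded by lintegral. -/
theorem enorm_integral_sub_le {α : Type*} [MeasurableSpace α] {μ : Measure α} {f g : α → ℝ}
    (hf : AEStronglyMeasurable f μ) (hg : AEStronglyMeasurable g μ) :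
    ‖(∫ x, f x ∂μ) - ∫ x, g x ∂μ‖ₑ ≤ ∫⁻ x, ‖f x - g x‖ₑ ∂μ := by
  by_cases h : (∫⁻ x, ‖f x - g x‖ₑ ∂μ) = ∞
  · rw [h]; exact le_top
  have hd : Integrable (fun x => f x - g x) μ :=
    ⟨hf.sub hg, lt_of_le_of_ne le_top h⟩
  by_cases hfi : Integrable f μ
  · have hgi : Integrable g μ := by
      have := hfi.sub hd
      refine this.congr (Eventually.of_forall fun x => ?_)
      simp
    rw [← integral_sub hfi hgi]
    exact enorm_integral_le_lintegral_enorm _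
  · have hgi : ¬ Integrable g μ := by
      intro hgi
      apply hfi
      refine (hgi.add hd).congr (Eventually.of_forall fun x => ?_)
      simp
    rw [integral_undef hfi, integral_undef hgi]
    simp

theorem measurable_betaOf {k₀ : ℝ} {bs : ℝ → ℝ → ℝ → ℝ} (hβ : FragKernel k₀ bs) :
    Measurable fun q : ℝ × ℝ × ℝ => betaOf bs q.2.2 q.1 q.2.1 := by
  unfold betaOf
  have h1 : Measurable fun q : ℝ × ℝ × ℝ => bs q.2.2 q.1 q.2.1 :=
    hβ.meas.comp (f := fun q : ℝ × ℝ × ℝ => (q.2.2, q.1, q.2.1)) (by fun_prop)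
  have h2 : Measurable fun q : ℝ × ℝ × ℝ => bs q.2.2 q.2.1 q.1 :=
    hβ.meas.comp (f := fun q : ℝ × ℝ × ℝ => (q.2.2, q.2.1, q.1)) (by fun_prop)
  refine Measurable.add (Measurable.ite ?_ h1 measurable_const)
    (Measurable.ite ?_ h2 measurable_const)
  · exact (measurableSet_lt (f := fun _ : ℝ × ℝ × ℝ => (0:ℝ)) (g := fun q => q.2.2)
        (by fun_prop) (by fun_prop)).inter
      (measurableSet_lt (f := fun q : ℝ × ℝ × ℝ => q.2.2) (g := fun q => q.1)
        (by fun_prop) (by fun_prop))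
  · exact (measurableSet_lt (f := fun _ : ℝ × ℝ × ℝ => (0:ℝ)) (g := fun q => q.2.2)
        (by fun_prop) (by fun_prop)).inter
      (measurableSet_lt (f := fun q : ℝ × ℝ × ℝ => q.2.2) (g := fun q => q.2.1)
        (by fun_prop) (by fun_prop))

theorem measurable_betaOf_sec {k₀ : ℝ} {bs : ℝ → ℝ → ℝ → ℝ} (hβ : FragKernel k₀ bs) (a b : ℝ) :
    Measurable fun x => betaOf bs x a b :=
  (measurable_betaOf hβ).comp (f := fun x : ℝ => (a, b, x)) (by fun_prop)

theorem measurable_Upsilon {k₀ : ℝ} {bs : ℝ → ℝ → ℝ → ℝ} (hβ : FragKernel k₀ bs) {s : ℝ → ℝ}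
    (hs : Measurable s) : Measurable fun q : ℝ × ℝ => Upsilon bs s q.1 q.2 := by
  unfold Upsilon
  refine Measurable.sub (Measurable.sub ?_ (hs.comp measurable_fst)) (hs.comp measurable_snd)
  have h : Measurable fun p : (ℝ × ℝ) × ℝ =>
      if p.2 ∈ Ioo (0:ℝ) (p.1.1 + p.1.2) then s p.2 * betaOf bs p.2 p.1.1 p.1.2 else 0 := by
    refine Measurable.ite ?_ ((hs.comp measurable_snd).mul ?_) measurable_const
    · exact (measurableSet_lt (f := fun _ : (ℝ × ℝ) × ℝ => (0:ℝ)) (g := fun q => q.2)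
          (by fun_prop) (by fun_prop)).inter
        (measurableSet_lt (f := fun q : (ℝ × ℝ) × ℝ => q.2) (g := fun q => q.1.1 + q.1.2)
          (by fun_prop) (by fun_prop))
    · exact (measurable_betaOf hβ).comp
        (f := fun p : (ℝ × ℝ) × ℝ => (p.1.1, p.1.2, p.2)) (by fun_prop)
  have h2 := (h.stronglyMeasurable.integral_prod_right' (ν := volume)).measurable
  convert h2 using 2 with q
  rw [← integral_indicator measurableSet_Ioo]
  refine integral_congr_ae (Eventually.of_forall fun y => ?_)
  simp only [indicator]

theorem betaOf_nonneg {k₀ : ℝ} {bs : ℝ → ℝ → ℝ → ℝ} (hβ : FragKernel k₀ bs) (x a b : ℝ) :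
    0 ≤ betaOf bs x a b := by
  unfold betaOf
  have := hβ.nonneg x a b
  have := hβ.nonneg x b a
  split_ifs <;> linarith

theorem lintegral_bs {k₀ : ℝ} {bs : ℝ → ℝ → ℝ → ℝ} (hβ : FragKernel k₀ bs) {a b : ℝ}
    (ha : 0 < a) (hb : 0 < b) :
    ∫⁻ x in Ioo (0:ℝ) a, ENNReal.ofReal (x * bs x a b) = ENNReal.ofReal a := by
  have hm := hβ.mass a ha b hb
  rw [← ofReal_integral_eq_lintegral_ofReal, hm]
  · by_contra hn
    rw [integral_undef hn] at hm
    linarith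
  · refine (ae_restrict_iff' measurableSet_Ioo).2 (Eventually.of_forall fun x hx => ?_)
    exact mul_nonneg hx.1.le (hβ.nonneg _ _ _)

theorem lintegral_beta {k₀ : ℝ} {bs : ℝ → ℝ → ℝ → ℝ} (hβ : FragKernel k₀ bs) {a b : ℝ}
    (ha : 0 < a) (hb : 0 < b) :
    ∫⁻ x in Ioo (0:ℝ) (a + b), ENNReal.ofReal (x * betaOf bs x a b) ≤ ENNReal.ofReal (a + b) := by
  rw [ENNReal.ofReal_add ha.le hb.le, ← lintegral_bs hβ ha hb, ← lintegral_bs hβ hb ha,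
    ← lintegral_indicator measurableSet_Ioo, ← lintegral_indicator measurableSet_Ioo,
    ← lintegral_indicator measurableSet_Ioo, ← lintegral_add_left]
  · refine lintegral_mono fun x => ?_
    by_cases h : x ∈ Ioo 0 (a + b)
    · rw [indicator_of_mem h]
      unfold betaOf
      simp only [indicator]
      have := hβ.nonneg x a b
      have := hβ.nonneg x b a
      rw [mul_add, ENNReal.ofReal_add]
      · split_ifs <;> simp
      · split_ifs <;> simp [mul_nonneg, h.1.le, *]
      · split_ifs <;> simp [mul_nonneg, h.1.le, *]
    · rw [indicator_of_notMem h]; exact zero_le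
  · refine Measurable.indicator ?_ measurableSet_Ioo
    have : Measurable fun x => bs x a b :=
      hβ.meas.comp (f := fun x : ℝ => (x, a, b)) (by fun_prop)
    fun_prop

/-- Difference of `Upsilon`s. -/
theorem enorm_Upsilon_sub_le {k₀ : ℝ} {bs : ℝ → ℝ → ℝ → ℝ} (hβ : FragKernel k₀ bs)
    {s r : ℝ → ℝ} (hs : Measurable s) (hr : Measurable r) (a b : ℝ) :
    ‖Upsilon bs s a b - Upsilon bs r a b‖ₑ ≤
      (∫⁻ x in Ioo (0:ℝ) (a + b), ‖s x - r x‖ₑ * ENNReal.ofReal (betaOf bs x a b))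
        + ‖s a - r a‖ₑ + ‖s b - r b‖ₑ := by
  have e : Upsilon bs s a b - Upsilon bs r a b =
      ((∫ x in Ioo (0:ℝ) (a + b), s x * betaOf bs x a b) -
        ∫ x in Ioo (0:ℝ) (a + b), r x * betaOf bs x a b) - (s a - r a) - (s b - r b) := by
    unfold Upsilon; ring
  have hm := measurable_betaOf_sec hβ a b
  rw [e]
  refine enorm_sub_le.trans (add_le_add_left (enorm_sub_le.trans (add_le_add_left ?_ _)) _)
  refine (enorm_integral_sub_le (hs.mul hm).aestronglyMeasurable
    (hr.mul hm).aestronglyMeasurable).trans (le_of_eq (lintegral_congr fun x => ?_))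
  simp only [Pi.mul_apply]
  rw [← sub_mul, enorm_mul, Real.enorm_of_nonneg (betaOf_nonneg hβ x a b)]

theorem beta_mul_le {k₀ : ℝ} {bs : ℝ → ℝ → ℝ → ℝ} (hβ : FragKernel k₀ bs)
    {s r : ℝ → ℝ} {A : ℝ} (h : ∀ x, 0 ≤ x → |s x - r x| ≤ A * x) {x : ℝ} (hx : 0 ≤ x) (a b : ℝ) :
    ‖s x - r x‖ₑ * ENNReal.ofReal (betaOf bs x a b) ≤
      ENNReal.ofReal A * ENNReal.ofReal (x * betaOf bs x a b) := by
  rw [ENNReal.ofReal_mul hx, ← mul_assoc, ← ENNReal.ofReal_mul' hx, Real.enorm_eq_ofReal_abs]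
  gcongr
  exact h x hx

theorem Upsilon_sub_bound {k₀ : ℝ} {bs : ℝ → ℝ → ℝ → ℝ} (hβ : FragKernel k₀ bs)
    {s r : ℝ → ℝ} (hs : Measurable s) (hr : Measurable r) {A : ℝ} (hA : 0 ≤ A)
    (h : ∀ x, 0 ≤ x → |s x - r x| ≤ A * x) {a b : ℝ} (ha : 0 < a) (hb : 0 < b) :
    ‖Upsilon bs s a b - Upsilon bs r a b‖ₑ ≤ ENNReal.ofReal (2 * A * (a + b)) := by
  refine (enorm_Upsilon_sub_le hβ hs hr a b).trans ?_
  have h1 : (∫⁻ x in Ioo (0:ℝ) (a + b), ‖s x - r x‖ₑ * ENNReal.ofReal (betaOf bs x a b))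
      ≤ ENNReal.ofReal (A * (a + b)) := by
    calc _ ≤ ∫⁻ x in Ioo (0:ℝ) (a + b),
          ENNReal.ofReal A * ENNReal.ofReal (x * betaOf bs x a b) :=
          setLIntegral_mono' measurableSet_Ioo fun x hx => beta_mul_le hβ h hx.1.le a b
      _ = ENNReal.ofReal A * ∫⁻ x in Ioo (0:ℝ) (a + b), ENNReal.ofReal (x * betaOf bs x a b) :=
          lintegral_const_mul' _ _ ENNReal.ofReal_ne_top
      _ ≤ ENNReal.ofReal A * ENNReal.ofReal (a + b) := by gcongr; exact lintegral_beta hβ ha hb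
      _ = _ := (ENNReal.ofReal_mul hA).symm
  have h2 : ∀ x, 0 < x → ‖s x - r x‖ₑ ≤ ENNReal.ofReal (A * x) := fun x hx => by
    rw [Real.enorm_eq_ofReal_abs]; exact ENNReal.ofReal_le_ofReal (h x hx.le)
  have e : 2 * A * (a + b) = A * (a + b) + A * a + A * b := by ring
  rw [e, ENNReal.ofReal_add (by positivity) (by positivity),
    ENNReal.ofReal_add (by positivity) (by positivity)]
  exact add_le_add (add_le_add h1 (h2 a ha)) (h2 b hb)

theorem Upsilon_sub_tendsto {k₀ : ℝ} {bs : ℝ → ℝ → ℝ → ℝ} (hβ : FragKernel k₀ bs)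
    {s : ℝ → ℝ} {r : ℕ → ℝ → ℝ} (hs : Measurable s) (hr : ∀ n, Measurable (r n)) {A : ℝ}
    (h : ∀ n x, 0 ≤ x → |s x - r n x| ≤ A * x)
    (hlim : ∀ x, Tendsto (fun n => ‖s x - r n x‖ₑ) atTop (nhds 0))
    {a b : ℝ} (ha : 0 < a) (hb : 0 < b) :
    Tendsto (fun n => ‖Upsilon bs s a b - Upsilon bs (r n) a b‖ₑ) atTop (nhds 0) := by
  have hm := measurable_betaOf_sec hβ a b
  have h1 : Tendsto (fun n => ∫⁻ x in Ioo (0:ℝ) (a + b),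
      ‖s x - r n x‖ₑ * ENNReal.ofReal (betaOf bs x a b)) atTop
      (nhds (∫⁻ x in Ioo (0:ℝ) (a + b), 0)) := by
    refine tendsto_lintegral_of_dominated_convergence
      (fun x => ENNReal.ofReal A * ENNReal.ofReal (x * betaOf bs x a b)) ?_ ?_ ?_ ?_
    · intro n
      have := hr n
      fun_prop
    · intro n
      exact (ae_restrict_iff' measurableSet_Ioo).2 (Eventually.of_forall fun x hx =>
        beta_mul_le hβ (h n) hx.1.le a b)
    · rw [lintegral_const_mul' _ _ ENNReal.ofReal_ne_top]
      exact ENNReal.mul_ne_top ENNReal.ofReal_ne_top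
        (ne_top_of_le_ne_top ENNReal.ofReal_ne_top (lintegral_beta hβ ha hb))
    · refine Eventually.of_forall fun x => ?_
      have := ENNReal.Tendsto.mul_const (b := ENNReal.ofReal (betaOf bs x a b)) (hlim x)
        (Or.inr ENNReal.ofReal_ne_top)
      simpa using this
  have h2 := (h1.add (hlim a)).add (hlim b)
  simp only [lintegral_zero, add_zero] at h2
  exact tendsto_of_tendsto_of_tendsto_of_le_of_le tendsto_const_nhds h2 (fun _ => zero_le)
    fun n => enorm_Upsilon_sub_le hβ hs (hr n) a b

/-- single integrals converge -/
theorem single_tendsto {s v : ℝ → ℝ} {r : ℕ → ℝ → ℝ} (hs : Measurable s) (hv : Measurable v)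
    (hr : ∀ n, Measurable (r n)) {A : ℝ}
    (h : ∀ n x, 0 ≤ x → |s x - r n x| ≤ A * x)
    (hlim : ∀ x, Tendsto (fun n => ‖s x - r n x‖ₑ) atTop (nhds 0))
    (hfin : (∫⁻ x in Ioi (0:ℝ), ‖x * v x‖ₑ) ≠ ∞) :
    Tendsto (fun n => ∫ x in Ioi (0:ℝ), r n x * v x) atTop
      (nhds (∫ x in Ioi (0:ℝ), s x * v x)) := by
  have h1 : Tendsto (fun n => ∫⁻ x in Ioi (0:ℝ), ‖s x * v x - r n x * v x‖ₑ) atTop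
      (nhds (∫⁻ x in Ioi (0:ℝ), 0)) := by
    refine tendsto_lintegral_of_dominated_convergence
      (fun x => ENNReal.ofReal A * ‖x * v x‖ₑ) ?_ ?_ ?_ ?_
    · intro n
      have := hr n
      fun_prop
    · intro n
      refine (ae_restrict_iff' measurableSet_Ioi).2 (Eventually.of_forall fun x hx => ?_)
      have hx' : 0 ≤ x := le_of_lt hx
      simp only
      rw [← sub_mul, enorm_mul, enorm_mul, ← mul_assoc, Real.enorm_of_nonneg hx',
        ← ENNReal.ofReal_mul' hx', Real.enorm_eq_ofReal_abs (s x - r n x)]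
      gcongr
      exact h n x hx'
    · rw [lintegral_const_mul' _ _ ENNReal.ofReal_ne_top]
      exact ENNReal.mul_ne_top ENNReal.ofReal_ne_top hfin
    · refine Eventually.of_forall fun x => ?_
      have := ENNReal.Tendsto.mul_const (b := ‖v x‖ₑ) (hlim x) (Or.inr enorm_ne_top)
      simpa [← sub_mul, enorm_mul] using this
  rw [tendsto_iff_edist_tendsto_0]
  simp only [lintegral_zero] at h1
  refine tendsto_of_tendsto_of_tendsto_of_le_of_le tendsto_const_nhds h1 (fun _ => zero_le)
    fun n => ?_
  simp only
  rw [edist_comm, edist_eq_enorm_sub]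
  exact enorm_integral_sub_le (hs.mul hv).aestronglyMeasurable
    ((hr n).mul hv).aestronglyMeasurable

theorem enorm_triple_sub_le {μ ν : Measure ℝ} [SFinite μ] [SFinite ν] {f g : ℝ × ℝ × ℝ → ℝ}
    (hf : Measurable f) (hg : Measurable g) :
    ‖(∫ t, ∫ x, ∫ y, f (t, x, y) ∂ν ∂ν ∂μ) - ∫ t, ∫ x, ∫ y, g (t, x, y) ∂ν ∂ν ∂μ‖ₑ ≤
      ∫⁻ q, ‖f q - g q‖ₑ ∂(μ.prod (ν.prod ν)) := by
  have m2 : ∀ f : ℝ × ℝ × ℝ → ℝ, Measurable f →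
      StronglyMeasurable fun p : ℝ × ℝ => ∫ y, f (p.1, p.2, y) ∂ν := by
    intro f hf
    have : Measurable fun p : (ℝ × ℝ) × ℝ => f (p.1.1, p.1.2, p.2) :=
      hf.comp (by fun_prop)
    exact this.stronglyMeasurable.integral_prod_right'
  have m1 : ∀ f : ℝ × ℝ × ℝ → ℝ, Measurable f →
      StronglyMeasurable fun t : ℝ => ∫ x, ∫ y, f (t, x, y) ∂ν ∂ν := fun f hf =>
    (m2 f hf).integral_prod_right'
  have hd : Measurable fun q => ‖f q - g q‖ₑ := (hf.sub hg).enorm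
  rw [lintegral_prod _ hd.aemeasurable]
  refine (enorm_integral_sub_le (m1 f hf).aestronglyMeasurable
    (m1 g hg).aestronglyMeasurable).trans (lintegral_mono fun t => ?_)
  have hd' : Measurable fun y : ℝ × ℝ => ‖f (t, y) - g (t, y)‖ₑ :=
    hd.comp measurable_prodMk_left
  rw [lintegral_prod _ hd'.aemeasurable]
  refine (enorm_integral_sub_le
    ((m2 f hf).comp_measurable measurable_prodMk_left).aestronglyMeasurable
    ((m2 g hg).comp_measurable measurable_prodMk_left).aestronglyMeasurable).trans
    (lintegral_mono fun x => ?_)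
  exact enorm_integral_sub_le
    (hf.comp (f := fun y => (t, x, y)) (by fun_prop)).aestronglyMeasurable
    (hg.comp (f := fun y => (t, x, y)) (by fun_prop)).aestronglyMeasurable

theorem triple_tendsto {k₀ : ℝ} {bs : ℝ → ℝ → ℝ → ℝ} (hβ : FragKernel k₀ bs)
    {s : ℝ → ℝ} {r : ℕ → ℝ → ℝ} (hs : Measurable s) (hr : ∀ n, Measurable (r n)) {A : ℝ}
    (hA : 0 ≤ A)
    (h : ∀ n x, 0 ≤ x → |s x - r n x| ≤ A * x)
    (hlim : ∀ x, Tendsto (fun n => ‖s x - r n x‖ₑ) atTop (nhds 0))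
    {K : ℝ → ℝ → ℝ} (hK : Measurable (Function.uncurry K))
    {u : ℝ → ℝ → ℝ} (hu : Measurable (Function.uncurry u)) {t : ℝ}
    (hint : IntegrableOn
        (fun q : ℝ × ℝ × ℝ => (q.2.1 + q.2.2) * K q.2.1 q.2.2 * u q.1 q.2.1 * u q.1 q.2.2)
        (Ioo (0:ℝ) t ×ˢ (Ioi (0:ℝ) ×ˢ Ioi (0:ℝ)))) :
    Tendsto (fun n => ∫ τ in Ioo (0:ℝ) t, ∫ x₁ in Ioi (0:ℝ), ∫ x₂ in Ioi (0:ℝ),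
        Upsilon bs (r n) x₁ x₂ * K x₁ x₂ * u τ x₁ * u τ x₂) atTop
      (nhds (∫ τ in Ioo (0:ℝ) t, ∫ x₁ in Ioi (0:ℝ), ∫ x₂ in Ioi (0:ℝ),
        Upsilon bs s x₁ x₂ * K x₁ x₂ * u τ x₁ * u τ x₂)) := by
  have mF : ∀ s : ℝ → ℝ, Measurable s → Measurable fun q : ℝ × ℝ × ℝ =>
      Upsilon bs s q.2.1 q.2.2 * K q.2.1 q.2.2 * u q.1 q.2.1 * u q.1 q.2.2 := by
    intro s hs
    have a1 : Measurable fun q : ℝ × ℝ × ℝ => Upsilon bs s q.2.1 q.2.2 :=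
      (measurable_Upsilon hβ hs).comp measurable_snd
    have a2 : Measurable fun q : ℝ × ℝ × ℝ => K q.2.1 q.2.2 := hK.comp measurable_snd
    have a3 := hu.comp (f := fun q : ℝ × ℝ × ℝ => (q.1, q.2.1)) (by fun_prop)
    have a4 := hu.comp (f := fun q : ℝ × ℝ × ℝ => (q.1, q.2.2)) (by fun_prop)
    exact ((a1.mul a2).mul a3).mul a4
  have hS : MeasurableSet (Ioo (0:ℝ) t ×ˢ (Ioi (0:ℝ) ×ˢ Ioi (0:ℝ))) :=
    measurableSet_Ioo.prod (measurableSet_Ioi.prod measurableSet_Ioi)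
  have hμ : (volume.restrict (Ioo (0:ℝ) t)).prod
      ((volume.restrict (Ioi (0:ℝ))).prod (volume.restrict (Ioi (0:ℝ)))) =
      (volume : Measure (ℝ × ℝ × ℝ)).restrict (Ioo (0:ℝ) t ×ˢ (Ioi (0:ℝ) ×ˢ Ioi (0:ℝ))) := by
    rw [Measure.prod_restrict, Measure.prod_restrict]; rfl
  have e : ∀ n (q : ℝ × ℝ × ℝ),
      ‖Upsilon bs s q.2.1 q.2.2 * K q.2.1 q.2.2 * u q.1 q.2.1 * u q.1 q.2.2 -
        Upsilon bs (r n) q.2.1 q.2.2 * K q.2.1 q.2.2 * u q.1 q.2.1 * u q.1 q.2.2‖ₑ =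
      ‖Upsilon bs s q.2.1 q.2.2 - Upsilon bs (r n) q.2.1 q.2.2‖ₑ *
        ‖K q.2.1 q.2.2 * u q.1 q.2.1 * u q.1 q.2.2‖ₑ := by
    intro n q
    rw [← enorm_mul]; congr 1; ring
  have h1 : Tendsto (fun n => ∫⁻ q in Ioo (0:ℝ) t ×ˢ (Ioi (0:ℝ) ×ˢ Ioi (0:ℝ)),
      ‖Upsilon bs s q.2.1 q.2.2 * K q.2.1 q.2.2 * u q.1 q.2.1 * u q.1 q.2.2 -
        Upsilon bs (r n) q.2.1 q.2.2 * K q.2.1 q.2.2 * u q.1 q.2.1 * u q.1 q.2.2‖ₑ) atTop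
      (nhds (∫⁻ q : ℝ × ℝ × ℝ in Ioo (0:ℝ) t ×ˢ (Ioi (0:ℝ) ×ˢ Ioi (0:ℝ)), 0)) := by
    refine tendsto_lintegral_of_dominated_convergence
      (fun q => ENNReal.ofReal (2 * A) *
        ‖(q.2.1 + q.2.2) * K q.2.1 q.2.2 * u q.1 q.2.1 * u q.1 q.2.2‖ₑ) ?_ ?_ ?_ ?_
    · intro n
      exact ((mF s hs).sub (mF _ (hr n))).enorm
    · intro n
      refine (ae_restrict_iff' hS).2 (Eventually.of_forall fun q hq => ?_)
      obtain ⟨-, h1, h2⟩ := hq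
      have h1 : 0 < q.2.1 := h1
      have h2 : 0 < q.2.2 := h2
      simp only
      rw [e, mul_assoc (q.2.1 + q.2.2), mul_assoc (q.2.1 + q.2.2), enorm_mul (q.2.1 + q.2.2),
        ← mul_assoc, Real.enorm_of_nonneg (by positivity : 0 ≤ q.2.1 + q.2.2),
        ← ENNReal.ofReal_mul (by positivity)]
      gcongr
      exact Upsilon_sub_bound hβ hs (hr n) hA (h n) h1 h2
    · rw [lintegral_const_mul' _ _ ENNReal.ofReal_ne_top]
      exact ENNReal.mul_ne_top ENNReal.ofReal_ne_top hint.2.ne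
    · refine (ae_restrict_iff' hS).2 (Eventually.of_forall fun q hq => ?_)
      simp only [e]
      have := ENNReal.Tendsto.mul_const (b := ‖K q.2.1 q.2.2 * u q.1 q.2.1 * u q.1 q.2.2‖ₑ)
        (Upsilon_sub_tendsto hβ hs hr h hlim hq.2.1 hq.2.2) (Or.inr enorm_ne_top)
      simpa using this
  rw [tendsto_iff_edist_tendsto_0]
  simp only [lintegral_zero] at h1
  refine tendsto_of_tendsto_of_tendsto_of_le_of_le tendsto_const_nhds h1 (fun _ => zero_le)
    fun n => ?_
  simp only
  rw [edist_comm, edist_eq_enorm_sub, ← hμ]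
  exact enorm_triple_sub_le (mF s hs) (mF _ (hr n))

/-- The truncation of a test function. -/
def clampFn (s : ℝ → ℝ) (n : ℕ) (x : ℝ) : ℝ := max (min (s x) (n + 1)) (-(n + 1))

theorem clampFn_eq {s : ℝ → ℝ} {n : ℕ} {x : ℝ} (h : |s x| ≤ n + 1) : clampFn s n x = s x := by
  rw [abs_le] at h
  unfold clampFn
  rw [min_eq_left h.2, max_eq_left h.1]

theorem clampFn_abs (s : ℝ → ℝ) (n : ℕ) (x : ℝ) : |clampFn s n x| ≤ n + 1 := by
  have : (0:ℝ) ≤ n := n.cast_nonneg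
  unfold clampFn
  rw [abs_le]
  exact ⟨le_max_right _ _, max_le (min_le_right _ _) (by linarith)⟩

theorem clampFn_lip (s : ℝ → ℝ) (n : ℕ) (x y : ℝ) :
    |clampFn s n x - clampFn s n y| ≤ |s x - s y| := by
  unfold clampFn
  exact (abs_max_sub_max_le_abs _ _ _).trans (abs_min_sub_min_le_max _ _ _ _ |>.trans (by simp))

theorem clampFn_sub (s : ℝ → ℝ) (n : ℕ) (x : ℝ) : |s x - clampFn s n x| ≤ |s x| := by
  have : (0:ℝ) ≤ n := n.cast_nonneg
  unfold clampFn
  rcases le_total (s x) (n + 1) with h | h <;> rcases le_total (-(n + 1 : ℝ)) (s x) with h' | h'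
  · rw [min_eq_left h, max_eq_left h', sub_self, abs_zero]; exact abs_nonneg _
  · rw [min_eq_left h, max_eq_right h', abs_le, abs_of_nonpos (by linarith)]
    constructor <;> linarith
  · rw [min_eq_right h, max_eq_left (by linarith), abs_le, abs_of_nonneg (by linarith)]
    constructor <;> linarith
  · linarith

theorem ext_aux
    (k₀ l₁ l₂ : ℝ) (hk₀ : k₀ ∈ Ioo (0:ℝ) 1)
    (bs : ℝ → ℝ → ℝ → ℝ) (hβ : FragKernel k₀ bs)
    (uin : ℝ → ℝ) (hmeas : Measurable uin) 
    (hX1 : MemXk 1 uin)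
    (T : ℝ≥0∞) 
    (u : ℝ → ℝ → ℝ) (hu : IsWeakSolution k₀ bs (Phi l₁ l₂) uin T u)
    (hint : ∀ t : ℝ, 0 < t → ENNReal.ofReal t < T →
      MeasureTheory.IntegrableOn
        (fun q : ℝ × ℝ × ℝ =>
          (q.2.1 + q.2.2) * Phi l₁ l₂ q.2.1 q.2.2 * u q.1 q.2.1 * u q.1 q.2.2)
        (Ioo (0:ℝ) t ×ˢ (Ioi (0:ℝ) ×ˢ Ioi (0:ℝ))))
    (s : ℝ → ℝ) (hs : Measurable s) (hs0 : s 0 = 0) (H C : ℝ)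
    (hH : ∀ a b : ℝ, 0 ≤ a → 0 ≤ b → |s a - s b| ≤ H * |a - b| ^ k₀)
    (hC : ∀ x : ℝ, 1 < x → |s x| ≤ C * x)
    (t : ℝ) (ht : 0 < t) (htT : ENNReal.ofReal t < T) :
        ∫ x in Ioi (0:ℝ), s x * u t x =
          (∫ x in Ioi (0:ℝ), s x * uin x) +
          (1/2) * ∫ τ in Ioo (0:ℝ) t, ∫ x₁ in Ioi (0:ℝ), ∫ x₂ in Ioi (0:ℝ),
            Upsilon bs s x₁ x₂ * Phi l₁ l₂ x₁ x₂ * u τ x₁ * u τ x₂ := by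
  have hH0 : 0 ≤ H := by
    have := (abs_nonneg _).trans (hH 1 0 zero_le_one le_rfl)
    simpa using this
  have hsx : ∀ x, 0 ≤ x → |s x| ≤ H * x ^ k₀ := fun x hx => by
    simpa [hs0, abs_of_nonneg hx] using hH x 0 hx le_rfl
  obtain ⟨δ, hδ, hδs⟩ : ∃ δ > 0, ∀ x, 0 ≤ x → x < δ → |s x| ≤ 1 := by
    have hc : Tendsto (fun x : ℝ => H * x ^ k₀) (nhds 0) (nhds (H * 0 ^ k₀)) :=
      ((Real.continuousAt_rpow_const 0 k₀ (Or.inr hk₀.1.le)).tendsto).const_mul H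
    rw [Real.zero_rpow hk₀.1.ne', mul_zero] at hc
    obtain ⟨δ, hδ, h⟩ := Metric.eventually_nhds_iff.1 (hc.eventually (gt_mem_nhds zero_lt_one))
    refine ⟨δ, hδ, fun x hx hxd => (hsx x hx).trans (h ?_).le⟩
    simpa [abs_of_nonneg hx] using hxd
  set A : ℝ := max C (H / δ) with hAdef
  have hA : 0 ≤ A := le_max_of_le_right (by positivity)
  have hr : ∀ n, Measurable (clampFn s n) := fun n => by
    unfold clampFn; fun_prop
  have hb : ∀ n x, 0 ≤ x → |s x - clampFn s n x| ≤ A * x := by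
    intro n x hx
    by_cases h1 : |s x| ≤ 1
    · rw [clampFn_eq (h1.trans (by have : (0:ℝ) ≤ n := n.cast_nonneg
                                   linarith))]
      simp; positivity
    refine (clampFn_sub s n x).trans ?_
    rcases lt_or_ge 1 x with hx1 | hx1
    · exact (hC x hx1).trans (by gcongr; exact le_max_left _ _)
    · have hxd : δ ≤ x := by
        by_contra hlt
        exact h1 (hδs x hx (not_le.1 hlt))
      calc |s x| ≤ H * x ^ k₀ := hsx x hx
        _ ≤ H * 1 := by gcongr; exact Real.rpow_le_one hx hx1 hk₀.1.le
        _ = H / δ * δ := by field_simp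
        _ ≤ A * x := by gcongr; exact le_max_right _ _
  have hlim : ∀ x, Tendsto (fun n => ‖s x - clampFn s n x‖ₑ) atTop (nhds 0) := by
    intro x
    refine tendsto_const_nhds.congr' ?_
    obtain ⟨N, hN⟩ := exists_nat_ge |s x|
    filter_upwards [eventually_ge_atTop N] with n hn
    have : (N:ℝ) ≤ n := by exact_mod_cast hn
    rw [clampFn_eq (by linarith)]
    simp
  have hu1 : Measurable (u t) := hu.meas.comp (f := fun x => (t, x)) (by fun_prop)
  have hK : Measurable (Function.uncurry (Phi l₁ l₂)) := by
    unfold Phi Function.uncurry; fun_prop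
  have L1 := single_tendsto (v := u t) hs hu1 hr hb hlim (by
    obtain ⟨D, hD⟩ := hu.massBdd
    refine ne_top_of_le_ne_top (ENNReal.ofReal_ne_top (r := D)) (le_trans (le_of_eq ?_)
      (hD t ht.le htT))
    refine setLIntegral_congr_fun measurableSet_Ioi fun x hx => ?_
    exact Real.enorm_of_nonneg (mul_nonneg (le_of_lt hx) (hu.nonneg t ht.le htT x hx)))
  have L2 := single_tendsto (v := uin) hs hmeas hr hb hlim (by
    have := hX1.2.ne
    simpa using this)
  have L3 := triple_tendsto hβ hs hr hA hb hlim hK hu.meas (hint t ht htT)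
  refine tendsto_nhds_unique L1 ((L2.add (L3.const_mul (1/2))).congr fun n => ?_)
  refine (hu.weak t ht htT (clampFn s n) ⟨?_, H, fun a b ha hb => ?_⟩ ⟨n + 1, fun x _ => ?_⟩).symm
  · rw [clampFn_eq (by rw [hs0, abs_zero]; positivity), hs0]
  · exact (clampFn_lip s n a b).trans (hH a b ha hb)
  · exact clampFn_abs s n x

/-- Extension of the weak formulation to test functions with at most
linear growth at infinity. -/
theorem weak_formulation_extension
    (k₀ l₁ l₂ : ℝ) (hk₀ : k₀ ∈ Ioo (0:ℝ) 1)
    (bs : ℝ → ℝ → ℝ → ℝ) (hβ : FragKernel k₀ bs)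
    (hl₁ : k₀ ≤ l₁) (hl₁₂ : l₁ ≤ l₂) (hl₂ : l₂ ≤ 1)
    (uin : ℝ → ℝ) (hmeas : Measurable uin) (hnn : ∀ x : ℝ, 0 ≤ uin x)
    (hXk₀ : MemXk k₀ uin) (hX1 : MemXk 1 uin)
    (T : ℝ≥0∞) (hT : 0 < T)
    (u : ℝ → ℝ → ℝ) (hu : IsWeakSolution k₀ bs (Phi l₁ l₂) uin T u)
    (hint : ∀ t : ℝ, 0 < t → ENNReal.ofReal t < T →
      MeasureTheory.IntegrableOn
        (fun q : ℝ × ℝ × ℝ =>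
          (q.2.1 + q.2.2) * Phi l₁ l₂ q.2.1 q.2.2 * u q.1 q.2.1 * u q.1 q.2.2)
        (Ioo (0:ℝ) t ×ˢ (Ioi (0:ℝ) ×ˢ Ioi (0:ℝ)))) :
    ∀ ς : ℝ → ℝ, ς 0 = 0 →
      (∃ H : ℝ, ∀ a b : ℝ, 0 ≤ a → 0 ≤ b → |ς a - ς b| ≤ H * |a - b| ^ k₀) →
      (∃ C : ℝ, ∀ x : ℝ, 1 < x → |ς x| ≤ C * x) →
      ∀ t : ℝ, 0 < t → ENNReal.ofReal t < T →
        ∫ x in Ioi (0:ℝ), ς x * u t x =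
          (∫ x in Ioi (0:ℝ), ς x * uin x) +
          (1/2) * ∫ τ in Ioo (0:ℝ) t, ∫ x₁ in Ioi (0:ℝ), ∫ x₂ in Ioi (0:ℝ),
            Upsilon bs ς x₁ x₂ * Phi l₁ l₂ x₁ x₂ * u τ x₁ * u τ x₂ := by
  intro ς h0 ⟨H, hH⟩ ⟨C, hC⟩ t ht htT
  set s : ℝ → ℝ := fun x => ς (max x 0) with hsdef
  have hse : ∀ x, 0 ≤ x → s x = ς x := fun x hx => by simp [hsdef, max_eq_left hx]
  have hH' : ∀ a b : ℝ, 0 ≤ a → 0 ≤ b → |s a - s b| ≤ H * |a - b| ^ k₀ := by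
    intro a b ha hb
    rw [hse a ha, hse b hb]; exact hH a b ha hb
  have hH0 : 0 ≤ H := by
    have := (abs_nonneg _).trans (hH 1 0 zero_le_one le_rfl)
    simpa using this
  have hs : Measurable s := by
    refine Continuous.measurable (continuous_iff_continuousAt.2 fun x => ?_)
    have hc : Tendsto (fun y : ℝ => H * |max y 0 - max x 0| ^ k₀) (nhds x) (nhds 0) := by
      have : Continuous fun y : ℝ => H * |max y 0 - max x 0| ^ k₀ :=
        continuous_const.mul (Continuous.rpow_const (by fun_prop) fun _ => Or.inr hk₀.1.le)
      have h2 := this.tendsto x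
      simpa [Real.zero_rpow hk₀.1.ne'] using h2
    rw [ContinuousAt, tendsto_iff_dist_tendsto_zero]
    refine squeeze_zero (fun _ => dist_nonneg) (fun y => ?_) hc
    rw [Real.dist_eq]
    exact hH _ _ (le_max_right _ _) (le_max_right _ _)
  have key := ext_aux k₀ l₁ l₂ hk₀ bs hβ uin hmeas hX1 T u hu hint s hs
    (by rw [hse 0 le_rfl, h0]) H C hH' (fun x hx => by
      rw [hse x (by linarith)]; exact hC x hx) t ht htT
  have c1 : ∀ v : ℝ → ℝ, ∫ x in Ioi (0:ℝ), s x * v x = ∫ x in Ioi (0:ℝ), ς x * v x := fun v =>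
    setIntegral_congr_fun measurableSet_Ioi fun x hx => by
      rw [hse x (le_of_lt hx)]
  have c2 : ∀ x₁ ∈ Ioi (0:ℝ), ∀ x₂ ∈ Ioi (0:ℝ), Upsilon bs s x₁ x₂ = Upsilon bs ς x₁ x₂ := by
    intro x₁ h1 x₂ h2
    unfold Upsilon
    rw [hse x₁ (le_of_lt h1), hse x₂ (le_of_lt h2)]
    congr 2
    exact setIntegral_congr_fun measurableSet_Ioo fun x hx => by
      rw [hse x hx.1.le]
  rw [c1, c1] at key
  rw [key]
  congr 2
  refine setIntegral_congr_fun measurableSet_Ioo fun τ _ => ?_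
  refine setIntegral_congr_fun measurableSet_Ioi fun x₁ h1 => ?_
  refine setIntegral_congr_fun measurableSet_Ioi fun x₂ h2 => ?_
  rw [c2 x₁ h1 x₂ h2]

end
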